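/- For every n ≥ 0 and every i ∈ {1,2,3}, |S_n^i| = (5/3)^{n/2} · 540^{(3^n−1)/4} and |R_n| = (5/3)^{3n/2} · 540^{(3^n−1)/4} (identities of real numbers, the powers being real powers); in particular |S_n^1| = |S_n^2| = |S_n^3|. -/

import Mathlib

attribute [local instance] Classical.propDecidable

noncomputable section

/-- Points in the plane. -/
abbrev Pt : Type := ℝ × ℝ

/-- The three corner vertices `u₁ = (0,0)`, `u₂ = (1,0)`, `u₃ = (1/2, √3/2)`. -/
def cornerPt : Fin 3 → Pt
  | 0 => (0, 0)
  | 1 => (1, 0)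
  | 2 => (1 / 2, Real.sqrt 3 / 2)

/-- The similitude `ψ_i(x) = (x + u_i)/2`. -/
def psi (i : Fin 3) (x : Pt) : Pt := ((x.1 + (cornerPt i).1) / 2, (x.2 + (cornerPt i).2) / 2)

/-- Vertex set of the Sierpiński graph `G_n`. -/
def sierpV : ℕ → Finset Pt
  | 0 => {cornerPt 0, cornerPt 1, cornerPt 2}
  | n + 1 => (sierpV n).image (psi 0) ∪ (sierpV n).image (psi 1) ∪ (sierpV n).image (psi 2)

/-- Edge set of the Sierpiński graph `G_n`. -/
def sierpE : ℕ → Finset (Sym2 Pt)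
  | 0 => {s(cornerPt 0, cornerPt 1), s(cornerPt 1, cornerPt 2), s(cornerPt 2, cornerPt 0)}
  | n + 1 =>
      (sierpE n).image (Sym2.map (psi 0)) ∪ (sierpE n).image (Sym2.map (psi 1)) ∪
        (sierpE n).image (Sym2.map (psi 2))

/-- The simple graph spanned by a finite set of edges. -/
def graphOf (F : Finset (Sym2 Pt)) : SimpleGraph Pt := SimpleGraph.fromEdgeSet ↑F

/-- Spanning trees of `G_n`: acyclic edge subsets connecting all vertices of `G_n`. -/
def treeSet (n : ℕ) : Finset (Finset (Sym2 Pt)) :=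
  (sierpE n).powerset.filter fun F =>
    (graphOf F).IsAcyclic ∧ ∀ x ∈ sierpV n, ∀ y ∈ sierpV n, (graphOf F).Reachable x y

/-- `S_n^i` (with `i : Fin 3` zero-based): spanning forests of `G_n` with exactly two
components, one containing corner `i`, the other containing the two remaining corners. -/
def twoForestSet (n : ℕ) (i : Fin 3) : Finset (Finset (Sym2 Pt)) :=
  (sierpE n).powerset.filter fun F =>
    (graphOf F).IsAcyclic ∧
    (∀ j, j ≠ i → ¬ (graphOf F).Reachable (cornerPt i) (cornerPt j)) ∧
    (∀ j k, j ≠ i → k ≠ i → (graphOf F).Reachable (cornerPt j) (cornerPt k)) ∧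
    (∀ x ∈ sierpV n, ∃ j, (graphOf F).Reachable (cornerPt j) x)

/-- `R_n`: spanning forests of `G_n` with exactly three components, each containing
exactly one corner vertex. -/
def threeForestSet (n : ℕ) : Finset (Finset (Sym2 Pt)) :=
  (sierpE n).powerset.filter fun F =>
    (graphOf F).IsAcyclic ∧
    (∀ j k, j ≠ k → ¬ (graphOf F).Reachable (cornerPt j) (cornerPt k)) ∧
    (∀ x ∈ sierpV n, ∃ j, (graphOf F).Reachable (cornerPt j) x)

/-- Edges of the copy `ψ_i(G_n)` inside `G_{n+1}`. -/
def psiCellE (i : Fin 3) (n : ℕ) : Finset (Sym2 Pt) := (sierpE n).image (Sym2.map (psi i))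

/-- The class `T_n^i`: for `n ≥ 1`, spanning trees whose unique path from corner `i`
to any other corner `j` stays in `ψ_i(G_{n-1}) ∪ ψ_j(G_{n-1})`; for `n = 0` the
singleton consisting of the two edges of `G_0` incident with corner `i`. -/
def treeClass : ℕ → Fin 3 → Finset (Finset (Sym2 Pt))
  | 0, i => {(sierpE 0).filter fun e => cornerPt i ∈ e}
  | n + 1, i =>
      (treeSet (n + 1)).filter fun F =>
        ∀ j, j ≠ i → ∀ p : (graphOf F).Walk (cornerPt i) (cornerPt j), p.IsPath →
          ∀ e ∈ p.edges, e ∈ psiCellE i n ∪ psiCellE j n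

/-- `ψ_w = ψ_{w₁} ∘ ⋯ ∘ ψ_{w_k}` for a word `w` of length `k`. -/
def psiWord {k : ℕ} (w : Fin k → Fin 3) : Pt → Pt :=
  (List.ofFn w).foldr (fun i g => psi i ∘ g) id

/-- The restriction `π_w(F) = ψ_w^{-1}(F ∩ ψ_w(G_{m-k}))` of an edge set `F ⊆ E G_m`
to the `k`-part indexed by the word `w`, as a subgraph of `G_{m-k}`. -/
def restrictE {k : ℕ} (w : Fin k → Fin 3) (m : ℕ) (F : Finset (Sym2 Pt)) :
    Finset (Sym2 Pt) :=
  (sierpE (m - k)).filter fun e => Sym2.map (psiWord w) e ∈ F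

/-- Number of connected components of the subgraph with edge set `F`,
on the vertex set of `G_m`. -/
def ncomp (m : ℕ) (F : Finset (Sym2 Pt)) : ℕ :=
  Set.ncard {C : Set Pt | ∃ v ∈ sierpV m, C = {x : Pt | x ∈ sierpV m ∧ (graphOf F).Reachable v x}}

/-- Degree of `v` in the edge set `F`. -/
def degIn (F : Finset (Sym2 Pt)) (v : Pt) : ℕ := (F.filter fun e => v ∈ e).card

/-- The subgraph of `G_0` replacing a forest in `Q_1`, used in the trace construction. -/
def traceCell (g : Finset (Sym2 Pt)) : Finset (Sym2 Pt) :=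
  if g ∈ treeClass 1 0 then (sierpE 0).filter (fun e => cornerPt 0 ∈ e)
  else if g ∈ treeClass 1 1 then (sierpE 0).filter (fun e => cornerPt 1 ∈ e)
  else if g ∈ treeClass 1 2 then (sierpE 0).filter (fun e => cornerPt 2 ∈ e)
  else if g ∈ twoForestSet 1 0 then (sierpE 0).filter (fun e => cornerPt 0 ∉ e)
  else if g ∈ twoForestSet 1 1 then (sierpE 0).filter (fun e => cornerPt 1 ∉ e)
  else if g ∈ twoForestSet 1 2 then (sierpE 0).filter (fun e => cornerPt 2 ∉ e)
  else ∅

/-- The trace `Tr f ⊆ E G_n` of an edge set `f ⊆ E G_{n+1}`. -/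
def trace (n : ℕ) (f : Finset (Sym2 Pt)) : Finset (Sym2 Pt) :=
  Finset.univ.biUnion fun w : Fin n → Fin 3 =>
    (traceCell (restrictE w (n + 1) f)).image (Sym2.map (psiWord w))

/-- `Q_n = T_n ∪ S_n^1 ∪ S_n^2 ∪ S_n^3 ∪ R_n`. -/
def qSet (n : ℕ) : Finset (Finset (Sym2 Pt)) :=
  treeSet n ∪ twoForestSet n 0 ∪ twoForestSet n 1 ∪ twoForestSet n 2 ∪ threeForestSet n

section Patterns

/-- The partition of the three corners induced by a spanning forest in which every component
contains a corner. -/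
inductive Pattern
  | joined
  | split (i : Fin 3)
  | separate
  deriving DecidableEq, Fintype

namespace Pattern

/-- Two corners lie in the same block of the pattern. -/
def Rel : Pattern → Fin 3 → Fin 3 → Prop
  | joined, _, _ => True
  | split i, j, k => j = i ↔ k = i
  | separate, j, k => j = k

instance (q : Pattern) (j k : Fin 3) : Decidable (q.Rel j k) := by
  cases q <;> unfold Rel <;> infer_instance

theorem eq_of_rel_iff {p q : Pattern} (h : ∀ j k, p.Rel j k ↔ q.Rel j k) : p = q := by
  revert p q; decide

/-- The number of blocks of a pattern. -/
def parts : Pattern → ℕ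
  | joined => 1
  | split _ => 2
  | separate => 3

end Pattern

/-- Given relations `r i` on three cells with corners `u`, glued so that corner `j` of cell `i` is
corner `i` of cell `j`, the point `v` of cell `i` can be reached from the outer corner `u a` of
cell `a` by moving inside cells and switching cells at shared corners. -/
def Linked {α : Type*} (r : Fin 3 → α → α → Prop) (u : Fin 3 → α) (a i : Fin 3) (v : α) : Prop :=
  (i = a ∧ r a (u a) v) ∨
  (i ≠ a ∧ r a (u a) (u i) ∧ r i (u a) v) ∨
  (∃ b, b ≠ a ∧ i ≠ a ∧ i ≠ b ∧ r a (u a) (u b) ∧ r b (u a) (u i) ∧ r i (u b) v) ∨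
  (∃ b c, i = a ∧ b ≠ a ∧ c ≠ a ∧ b ≠ c ∧
    r a (u a) (u b) ∧ r b (u a) (u c) ∧ r c (u b) (u a) ∧ r a (u c) v)

instance (r : Fin 3 → Fin 3 → Fin 3 → Prop) [∀ i j k, Decidable (r i j k)] (u : Fin 3 → Fin 3)
    (a i v : Fin 3) : Decidable (Linked r u a i v) := by
  unfold Linked; infer_instance

/-- Gluing three cells with patterns `p` gives a forest with pattern `q`. -/
def Glues (p : Fin 3 → Pattern) (q : Pattern) : Prop :=
  ∑ i, (p i).parts = q.parts + 3 ∧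
  (∀ i j, ∃ a, Linked (fun i => (p i).Rel) id a i j) ∧
  ∀ a b, Linked (fun i => (p i).Rel) id a b b ↔ q.Rel a b

instance (p : Fin 3 → Pattern) (q : Pattern) : Decidable (Glues p q) := by
  unfold Glues; infer_instance

/-- The numbers of cells with pattern `joined` and with pattern `separate`. -/
def cellKinds (p : Fin 3 → Pattern) : ℕ × ℕ :=
  (Finset.card {i | p i = .joined}, Finset.card {i | p i = .separate})

theorem prod_eq_of_cellKinds {t s r : ℕ} {w : Pattern → ℕ} (ht : w .joined = t)
    (hs : ∀ i, w (.split i) = s) (hr : w .separate = r) (p : Fin 3 → Pattern) :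
    ∏ i, w (p i) = t ^ (cellKinds p).1 * r ^ (cellKinds p).2 *
      s ^ (3 - (cellKinds p).1 - (cellKinds p).2) := by
  simp only [cellKinds, Finset.card_filter, Fin.sum_univ_three, Fin.prod_univ_three]
  rcases p 0 with _ | i | _ <;> rcases p 1 with _ | j | _ <;> rcases p 2 with _ | k | _ <;>
    simp [ht, hs, hr, -mul_eq_mul_left_iff, -mul_eq_mul_right_iff] <;> ring

theorem sum_glues_of_cellKinds {t s r : ℕ} {w : Pattern → ℕ} (ht : w .joined = t)
    (hs : ∀ i, w (.split i) = s) (hr : w .separate = r) {q : Pattern} {m : Multiset (ℕ × ℕ)}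
    (hm : (Finset.univ.filter (Glues · q)).val.map cellKinds = m) :
    ∑ p with Glues p q, ∏ i, w (p i) =
      (m.map fun k => t ^ k.1 * r ^ k.2 * s ^ (3 - k.1 - k.2)).sum := by
  simp only [prod_eq_of_cellKinds ht hs hr, ← hm, Multiset.map_map]
  rfl

theorem sum_glues_joined {t s r : ℕ} {w : Pattern → ℕ} (ht : w .joined = t)
    (hs : ∀ i, w (.split i) = s) (hr : w .separate = r) :
    ∑ p with Glues p .joined, ∏ i, w (p i) = 6 * t ^ 2 * s := by
  rw [sum_glues_of_cellKinds ht hs hr (m := .replicate 6 (2, 0)) (by decide +kernel)]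
  simp only [Multiset.map_replicate, Multiset.sum_replicate, smul_eq_mul]
  ring

theorem sum_glues_split {t s r : ℕ} {w : Pattern → ℕ} (ht : w .joined = t)
    (hs : ∀ i, w (.split i) = s) (hr : w .separate = r) (i : Fin 3) :
    ∑ p with Glues p (.split i), ∏ i, w (p i) = 7 * t * s ^ 2 + t ^ 2 * r := by
  rw [sum_glues_of_cellKinds ht hs hr (m := .replicate 7 (1, 0) + {(2, 1)})
    (by revert i; decide +kernel)]
  simp only [Multiset.map_add, Multiset.map_replicate, Multiset.map_singleton, Multiset.sum_add,
    Multiset.sum_replicate, Multiset.sum_singleton, smul_eq_mul]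
  ring

theorem sum_glues_separate {t s r : ℕ} {w : Pattern → ℕ} (ht : w .joined = t)
    (hs : ∀ i, w (.split i) = s) (hr : w .separate = r) :
    ∑ p with Glues p .separate, ∏ i, w (p i) = 14 * s ^ 3 + 12 * t * s * r := by
  rw [sum_glues_of_cellKinds ht hs hr (m := .replicate 14 (0, 0) + .replicate 12 (1, 1))
    (by decide +kernel)]
  simp only [Multiset.map_add, Multiset.map_replicate, Multiset.sum_add, Multiset.sum_replicate,
    smul_eq_mul]
  ring

/-- In the triangle with edge set `A`, where edges are named by their opposite corners, the corners
`j` and `k` are connected. -/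
def TriangleLinked (A : Finset (Fin 3)) (j k : Fin 3) : Prop :=
  j = k ∨ (∃ i ∈ A, i ≠ j ∧ i ≠ k) ∨ (j ∈ A ∧ k ∈ A)

instance (A : Finset (Fin 3)) (j k : Fin 3) : Decidable (TriangleLinked A j k) := by
  unfold TriangleLinked; infer_instance

theorem TriangleLinked.trans_edge {A : Finset (Fin 3)} {i j l m : Fin 3}
    (h : TriangleLinked A j l) (hi : i ∈ A) (hl : i ≠ l) (hm : i ≠ m) : TriangleLinked A j m := by
  revert A i j l m; decide +kernel

theorem card_triangle_patterns (q : Pattern) :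
    Finset.card {A : Finset (Fin 3) | A.card + q.parts = 3 ∧
      ∀ j k, TriangleLinked A j k ↔ q.Rel j k} = if q = .joined then 3 else 1 := by
  revert q; decide +kernel

end Patterns

section LinkedLemmas
variable {α : Type*} {r : Fin 3 → α → α → Prop} {u : Fin 3 → α}

theorem Linked.trans {a i : Fin 3} {v w : α} (hr : ∀ i, Equivalence (r i))
    (h : Linked r u a i v) (hvw : r i v w) : Linked r u a i w := by
  obtain ⟨rfl, h1⟩ | ⟨hi, h1, h2⟩ | ⟨b, hb, hi, hib, h1, h2, h3⟩ |
    ⟨b, c, rfl, hb, hc, hbc, h1, h2, h3, h4⟩ := h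
  · exact .inl ⟨rfl, (hr _).trans h1 hvw⟩
  · exact .inr (.inl ⟨hi, h1, (hr _).trans h2 hvw⟩)
  · exact .inr (.inr (.inl ⟨b, hb, hi, hib, h1, h2, (hr _).trans h3 hvw⟩))
  · exact .inr (.inr (.inr ⟨b, c, rfl, hb, hc, hbc, h1, h2, h3, (hr _).trans h4 hvw⟩))

theorem Linked.exists_corner {a i : Fin 3} {v : α} (h : Linked r u a i v) :
    ∃ k, r i (u k) v := by
  obtain ⟨rfl, h1⟩ | ⟨-, -, h2⟩ | ⟨b, -, -, -, -, -, h3⟩ |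
    ⟨b, c, rfl, -, -, -, -, -, -, h4⟩ := h
  exacts [⟨_, h1⟩, ⟨_, h2⟩, ⟨_, h3⟩, ⟨_, h4⟩]

/-- Passing from one cell to another through their common corner. -/
theorem Linked.switch {a i j : Fin 3} (hr : ∀ i, Equivalence (r i))
    (h : Linked r u a i (u j)) : Linked r u a j (u i) := by
  by_cases hij : j = i
  · rwa [← hij] at h ⊢
  obtain ⟨rfl, h1⟩ | ⟨hi, h1, h2⟩ | ⟨b, hb, hi, hib, h1, h2, h3⟩ |
    ⟨b, c, rfl, hb, hc, hbc, h1, h2, h3, h4⟩ := h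
  · exact .inr (.inl ⟨hij, h1, (hr _).refl _⟩)
  · by_cases hja : j = a
    · subst hja; exact .inl ⟨rfl, h1⟩
    · exact .inr (.inr (.inl ⟨i, hi, hja, hij, h1, h2, (hr _).refl _⟩))
  · by_cases hja : j = a
    · subst hja
      exact .inr (.inr (.inr ⟨b, i, rfl, hb, hi, Ne.symm hib, h1, h2, h3, (hr _).refl _⟩))
    · obtain rfl : j = b := by omega
      exact .inr (.inl ⟨hb, h1, h2⟩)
  · obtain rfl | rfl : j = b ∨ j = c := by omega
    · exact .inr (.inl ⟨hb, h1, (hr _).refl _⟩)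
    · exact .inr (.inr (.inl ⟨b, hb, hij, Ne.symm hbc, h1, h2, h3⟩))

theorem linked_congr {r' : Fin 3 → Fin 3 → Fin 3 → Prop}
    (h : ∀ i j k, r i (u j) (u k) ↔ r' i j k) (a i v : Fin 3) :
    Linked r u a i (u v) ↔ Linked r' id a i v := by
  simp only [Linked, h, id]

end LinkedLemmas

section GraphLemmas
variable {V : Type*}

theorem SimpleGraph.Reachable.of_forall_adj {G : SimpleGraph V} {x y : V} (h : G.Reachable x y)
    {K : V → Prop} (hx : K x) (hK : ∀ u v, G.Adj u v → K u → K v) : K y := by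
  obtain ⟨p⟩ := h
  induction p with
  | nil => exact hx
  | cons hadj _ ih => exact ih (hK _ _ hadj hx)

theorem SimpleGraph.reachable_sup_edge_iff {G : SimpleGraph V} {u v x y : V} :
    (G ⊔ SimpleGraph.edge u v).Reachable x y ↔ G.Reachable x y ∨
      (G.Reachable x u ∧ G.Reachable v y) ∨ (G.Reachable x v ∧ G.Reachable u y) := by
  have mono {a b : V} (h : G.Reachable a b) : (G ⊔ SimpleGraph.edge u v).Reachable a b :=
    h.mono le_sup_left
  have huv : (G ⊔ SimpleGraph.edge u v).Reachable u v := by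
    by_cases h : u = v
    · rw [h]
    · exact SimpleGraph.Adj.reachable (.inr (by simp [SimpleGraph.edge_adj, h]))
  refine ⟨fun h => ?_, ?_⟩
  · refine h.of_forall_adj (K := fun y => G.Reachable x y ∨
      (G.Reachable x u ∧ G.Reachable v y) ∨ (G.Reachable x v ∧ G.Reachable u y)) (.inl .rfl) ?_
    rintro a b (hab | hab) ha
    · have hab := hab.reachable
      exact ha.imp (·.trans hab)
        (Or.imp (And.imp_right (·.trans hab)) (And.imp_right (·.trans hab)))
    · rw [SimpleGraph.edge_adj] at hab
      obtain ⟨⟨rfl, rfl⟩ | ⟨rfl, rfl⟩, -⟩ := hab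
      · obtain h | h | h := ha
        exacts [.inr (.inl ⟨h, .rfl⟩), .inr (.inl ⟨h.1, .rfl⟩), .inl h.1]
      · obtain h | h | h := ha
        exacts [.inr (.inr ⟨h, .rfl⟩), .inl h.1, .inr (.inr ⟨h.1, .rfl⟩)]
  · rintro (h | h | h)
    exacts [mono h, (mono h.1).trans (huv.trans (mono h.2)),
      (mono h.1).trans (huv.symm.trans (mono h.2))]

end GraphLemmas

theorem graphOf_adj {F : Finset (Sym2 Pt)} {x y : Pt} :
    (graphOf F).Adj x y ↔ s(x, y) ∈ F ∧ x ≠ y := by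
  simp [graphOf]

theorem graphOf_insert (F : Finset (Sym2 Pt)) (x y : Pt) :
    graphOf (insert s(x, y) F) = graphOf F ⊔ SimpleGraph.edge x y := by
  ext a b
  simp only [graphOf_adj, SimpleGraph.sup_adj, SimpleGraph.edge_adj, Finset.mem_insert,
    Sym2.eq_iff]
  tauto

/-- The number of connected components of the graph with edge set `F` that meet `W`. -/
def componentCount (W : Finset Pt) (F : Finset (Sym2 Pt)) : ℕ :=
  (W.image (graphOf F).connectedComponentMk).card

theorem componentCount_insert_of_reachable {F : Finset (Sym2 Pt)} {x y : Pt}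
    (h : (graphOf F).Reachable x y) (W : Finset Pt) :
    componentCount W (insert s(x, y) F) = componentCount W F := by
  have key (a b : Pt) : (graphOf (insert s(x, y) F)).Reachable a b ↔ (graphOf F).Reachable a b := by
    rw [graphOf_insert, SimpleGraph.reachable_sup_edge_iff]
    exact ⟨by rintro (h' | h' | h'); exacts [h', h'.1.trans (h.trans h'.2),
      h'.1.trans (h.symm.trans h'.2)], .inl⟩
  let φ : (graphOf F).ConnectedComponent → (graphOf (insert s(x, y) F)).ConnectedComponent :=
    SimpleGraph.ConnectedComponent.map (.ofLE (by rw [graphOf_insert]; exact le_sup_left))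
  have hφ : Function.Injective φ := by
    intro c d
    induction c using SimpleGraph.ConnectedComponent.ind
    induction d using SimpleGraph.ConnectedComponent.ind
    simp [φ, key]
  have : W.image (graphOf (insert s(x, y) F)).connectedComponentMk =
      (W.image (graphOf F).connectedComponentMk).image φ := by
    rw [Finset.image_image]; rfl
  rw [componentCount, this, Finset.card_image_of_injective _ hφ, componentCount]

theorem componentCount_insert_of_not_reachable {F : Finset (Sym2 Pt)} {x y : Pt}
    (h : ¬ (graphOf F).Reachable x y) {W : Finset Pt} (hx : x ∈ W) (hy : y ∈ W) :
    componentCount W (insert s(x, y) F) + 1 = componentCount W F := by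
  have key (a b : Pt) : (graphOf (insert s(x, y) F)).Reachable a b ↔ (graphOf F).Reachable a b ∨
      ((graphOf F).Reachable a x ∧ (graphOf F).Reachable y b) ∨
      ((graphOf F).Reachable a y ∧ (graphOf F).Reachable x b) := by
    rw [graphOf_insert, SimpleGraph.reachable_sup_edge_iff]
  let φ : (graphOf F).ConnectedComponent → (graphOf (insert s(x, y) F)).ConnectedComponent :=
    SimpleGraph.ConnectedComponent.map (.ofLE (by rw [graphOf_insert]; exact le_sup_left))
  set A := W.image (graphOf F).connectedComponentMk with hA
  have hyA : (graphOf F).connectedComponentMk y ∈ A := Finset.mem_image_of_mem _ hy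
  have hφ : Set.InjOn φ (A.erase ((graphOf F).connectedComponentMk y)) := by
    intro c hc d hd
    induction c using SimpleGraph.ConnectedComponent.ind
    induction d using SimpleGraph.ConnectedComponent.ind
    rename_i a b
    simp only [Finset.coe_erase, Set.mem_sdiff, Set.mem_singleton_iff,
      SimpleGraph.ConnectedComponent.eq] at hc hd
    simp only [φ, SimpleGraph.ConnectedComponent.map_mk, SimpleGraph.ConnectedComponent.eq,
      SimpleGraph.Hom.coe_ofLE, id, key]
    rintro (h' | h' | h')
    exacts [h', absurd h'.2.symm hd.2, absurd h'.1 hc.2]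
  have hxy : (graphOf F).connectedComponentMk x ≠ (graphOf F).connectedComponentMk y := by
    simpa using h
  have : W.image (graphOf (insert s(x, y) F)).connectedComponentMk =
      (A.erase ((graphOf F).connectedComponentMk y)).image φ := by
    have h1 : W.image (graphOf (insert s(x, y) F)).connectedComponentMk = A.image φ := by
      rw [hA, Finset.image_image]; rfl
    rw [h1]
    refine Finset.Subset.antisymm (fun c hc => ?_)
      (Finset.image_subset_image (Finset.erase_subset _ _))
    obtain ⟨d, hd, rfl⟩ := Finset.mem_image.1 hc
    by_cases hdy : d = (graphOf F).connectedComponentMk y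
    · refine Finset.mem_image.2 ⟨(graphOf F).connectedComponentMk x,
        Finset.mem_erase.2 ⟨hxy, Finset.mem_image_of_mem _ hx⟩, ?_⟩
      rw [hdy]
      simp [φ, key]
    · exact Finset.mem_image_of_mem _ (Finset.mem_erase.2 ⟨hdy, hd⟩)
  rw [componentCount, this, Finset.card_image_of_injOn hφ, Finset.card_erase_add_one hyA,
    componentCount]

/-- The numbers of edges and components of a finite graph add up to at least its number of
vertices, with equality iff the graph is a forest. -/
theorem card_le_and_isAcyclic_iff_card_add_componentCount {W : Finset Pt} {F : Finset (Sym2 Pt)}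
    (hF : ∀ e ∈ F, ¬ e.IsDiag ∧ ∀ x ∈ e, x ∈ W) :
    W.card ≤ F.card + componentCount W F ∧
      ((graphOf F).IsAcyclic ↔ F.card + componentCount W F = W.card) := by
  induction F using Finset.induction_on with
  | empty =>
    have hbot : graphOf ∅ = ⊥ := by simp [graphOf]
    have : componentCount W ∅ = W.card := by
      refine Finset.card_image_of_injective _ fun a b hab => ?_
      simpa [hbot] using hab
    simp [this, hbot]
  | insert e F he ih =>
    obtain ⟨ih1, ih2⟩ := ih fun e' he' => hF e' (Finset.mem_insert_of_mem he')
    have hFe := hF e (Finset.mem_insert_self _ _)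
    induction e with | h x y
    obtain ⟨hxy, hW⟩ := hFe
    have hxy : x ≠ y := by simpa using hxy
    have hacyc : (graphOf (insert s(x, y) F)).IsAcyclic ↔
        (graphOf F).IsAcyclic ∧ ¬ (graphOf F).Reachable x y := by
      rw [graphOf_insert, SimpleGraph.isAcyclic_sup_fromEdgeSet_iff]
      simp [graphOf_adj, hxy, he]
    rw [Finset.card_insert_of_notMem he, hacyc]
    by_cases h : (graphOf F).Reachable x y
    · rw [componentCount_insert_of_reachable h]
      refine ⟨by omega, ?_⟩
      simp only [h, not_true, and_false, false_iff]
      omega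
    · have := componentCount_insert_of_not_reachable h (hW x (by simp)) (hW y (by simp))
      refine ⟨by omega, ?_⟩
      rw [ih2]
      simp only [h, not_false_iff, and_true]
      omega

section Sierpinski

theorem cornerPt_injective : Function.Injective cornerPt := by
  have h3 : (0 : ℝ) < Real.sqrt 3 := by positivity
  intro i j h
  fin_cases i <;> fin_cases j <;> simp_all [cornerPt, Prod.ext_iff]

theorem psi_injective (i : Fin 3) : Function.Injective (psi i) := by
  intro x y h
  simp only [psi, Prod.mk.injEq] at h
  ext <;> linarith [h.1, h.2]

theorem psi_corner (i : Fin 3) : psi i (cornerPt i) = cornerPt i := by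
  simp [psi]

theorem psi_corner_comm (i j : Fin 3) : psi i (cornerPt j) = psi j (cornerPt i) := by
  simp [psi, add_comm]

theorem mem_sierpV_succ {n : ℕ} {x : Pt} :
    x ∈ sierpV (n + 1) ↔ ∃ i, ∃ v ∈ sierpV n, psi i v = x := by
  simp [sierpV, Fin.exists_fin_succ]

theorem mem_sierpE_succ {n : ℕ} {e : Sym2 Pt} :
    e ∈ sierpE (n + 1) ↔ ∃ i, ∃ d ∈ sierpE n, Sym2.map (psi i) d = e := by
  simp [sierpE, Fin.exists_fin_succ]

theorem cornerPt_mem_sierpV (n : ℕ) (i : Fin 3) : cornerPt i ∈ sierpV n := by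
  induction n with
  | zero => fin_cases i <;> simp [sierpV]
  | succ n ih => exact mem_sierpV_succ.2 ⟨i, _, ih, psi_corner i⟩

theorem sierpE_spec {n : ℕ} {e : Sym2 Pt} (he : e ∈ sierpE n) :
    ¬ e.IsDiag ∧ ∀ x ∈ e, x ∈ sierpV n := by
  induction n generalizing e with
  | zero =>
    simp only [sierpE, Finset.mem_insert, Finset.mem_singleton] at he
    obtain rfl | rfl | rfl := he <;>
      simp [cornerPt_injective.eq_iff, cornerPt_mem_sierpV 0]
  | succ n ih =>
    obtain ⟨i, d, hd, rfl⟩ := mem_sierpE_succ.1 he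
    obtain ⟨h1, h2⟩ := ih hd
    refine ⟨fun h => h1 ((Sym2.isDiag_map (psi_injective i)).1 h), fun x hx => ?_⟩
    obtain ⟨v, hv, rfl⟩ := Sym2.mem_map.1 hx
    exact mem_sierpV_succ.2 ⟨i, v, h2 v hv, rfl⟩

/-- The vertices lie in the triangle spanned by the corners. -/
theorem sierpV_mem_triangle {n : ℕ} {x : Pt} (hx : x ∈ sierpV n) :
    0 ≤ x.2 ∧ x.2 ≤ Real.sqrt 3 * x.1 ∧ x.2 ≤ Real.sqrt 3 * (1 - x.1) := by
  have h3 : (0 : ℝ) < Real.sqrt 3 := by positivity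
  induction n generalizing x with
  | zero =>
    simp only [sierpV, Finset.mem_insert, Finset.mem_singleton] at hx
    obtain rfl | rfl | rfl := hx <;> simp only [cornerPt] <;>
      refine ⟨?_, ?_, ?_⟩ <;> linarith
  | succ n ih =>
    obtain ⟨i, v, hv, rfl⟩ := mem_sierpV_succ.1 hx
    obtain ⟨h1, h2, h3⟩ := ih hv
    fin_cases i <;> simp only [psi, cornerPt] <;> refine ⟨?_, ?_, ?_⟩ <;> linarith

/-- Distinct cells meet only in their common corner. -/
theorem psi_eq_psi {n : ℕ} {i k : Fin 3} {v w : Pt} (hv : v ∈ sierpV n) (hw : w ∈ sierpV n)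
    (h : psi i v = psi k w) : (i = k ∧ v = w) ∨ (i ≠ k ∧ v = cornerPt k ∧ w = cornerPt i) := by
  by_cases hik : i = k
  · subst hik
    exact .inl ⟨rfl, psi_injective i h⟩
  refine .inr ⟨hik, ?_⟩
  have h3 : (0 : ℝ) < Real.sqrt 3 := by positivity
  obtain ⟨v1, v2⟩ := v
  obtain ⟨w1, w2⟩ := w
  obtain ⟨a1, a2, a3⟩ := sierpV_mem_triangle hv
  obtain ⟨b1, b2, b3⟩ := sierpV_mem_triangle hw
  obtain ⟨e1, e2⟩ := Prod.mk.inj h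
  dsimp only at *
  have cancel {a b : ℝ} (hab : Real.sqrt 3 * a = Real.sqrt 3 * b) : a = b :=
    mul_left_cancel₀ h3.ne' hab
  have e1 : v1 + (cornerPt i).1 = w1 + (cornerPt k).1 := by linarith
  have e2 : v2 + (cornerPt i).2 = w2 + (cornerPt k).2 := by linarith
  have e3 : Real.sqrt 3 * v1 + Real.sqrt 3 * (cornerPt i).1 =
      Real.sqrt 3 * w1 + Real.sqrt 3 * (cornerPt k).1 := by
    rw [← mul_add, ← mul_add, e1]
  fin_cases i <;> fin_cases k <;> first | exact absurd rfl hik | skip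
  all_goals
    simp only [cornerPt, Prod.mk.injEq] at *
    refine ⟨⟨cancel ?_, ?_⟩, cancel ?_, ?_⟩ <;> linarith

/-- The edge set of `G_{n+1}` made of the edge sets `f i` in the cells. -/
def glue (f : Fin 3 → Finset (Sym2 Pt)) : Finset (Sym2 Pt) :=
  Finset.univ.biUnion fun i => (f i).image (Sym2.map (psi i))

theorem mem_glue {f : Fin 3 → Finset (Sym2 Pt)} {e : Sym2 Pt} :
    e ∈ glue f ↔ ∃ i, ∃ d ∈ f i, Sym2.map (psi i) d = e := by
  simp [glue]

theorem map_psi_eq_map_psi {n : ℕ} {i k : Fin 3} {d e : Sym2 Pt} (hd : d ∈ sierpE n)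
    (he : e ∈ sierpE n) (h : Sym2.map (psi i) d = Sym2.map (psi k) e) : i = k ∧ d = e := by
  suffices i = k by
    subst this
    exact ⟨rfl, Sym2.map.injective (psi_injective i) h⟩
  by_contra hik
  obtain ⟨hdiag, hmem⟩ := sierpE_spec hd
  have hcorner (x : Pt) (hx : x ∈ d) : x = cornerPt k := by
    have : psi i x ∈ Sym2.map (psi k) e := h ▸ Sym2.mem_map.2 ⟨x, hx, rfl⟩
    obtain ⟨y, hy, hyx⟩ := Sym2.mem_map.1 this
    obtain h' | h' := psi_eq_psi (hmem x hx) ((sierpE_spec he).2 y hy) hyx.symm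
    exacts [absurd h'.1 hik, h'.2.1]
  induction d with | h x y
  exact hdiag (by simp [hcorner x (by simp), hcorner y (by simp)])

variable {n : ℕ} {f : Fin 3 → Finset (Sym2 Pt)}

theorem map_psi_mem_glue (hf : ∀ i, f i ⊆ sierpE n) {i : Fin 3} {d : Sym2 Pt}
    (hd : d ∈ sierpE n) : Sym2.map (psi i) d ∈ glue f ↔ d ∈ f i := by
  rw [mem_glue]
  refine ⟨fun ⟨k, e, he, h⟩ => ?_, fun h => ⟨i, d, h, rfl⟩⟩
  obtain ⟨rfl, rfl⟩ := map_psi_eq_map_psi (hf k he) hd h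
  exact he

theorem glue_injOn {g : Fin 3 → Finset (Sym2 Pt)} (hf : ∀ i, f i ⊆ sierpE n)
    (hg : ∀ i, g i ⊆ sierpE n) (h : glue f = glue g) : f = g := by
  ext i d
  by_cases hd : d ∈ sierpE n
  · rw [← map_psi_mem_glue hf hd, h, map_psi_mem_glue hg hd]
  · exact iff_of_false (fun h' => hd (hf i h')) (fun h' => hd (hg i h'))

theorem glue_subset (hf : ∀ i, f i ⊆ sierpE n) : glue f ⊆ sierpE (n + 1) := by
  intro e he
  obtain ⟨i, d, hd, rfl⟩ := mem_glue.1 he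
  exact mem_sierpE_succ.2 ⟨i, d, hf i hd, rfl⟩

theorem exists_glue_eq {F : Finset (Sym2 Pt)} (hF : F ⊆ sierpE (n + 1)) :
    ∃ f : Fin 3 → Finset (Sym2 Pt), (∀ i, f i ⊆ sierpE n) ∧ glue f = F := by
  refine ⟨fun i => {d ∈ sierpE n | Sym2.map (psi i) d ∈ F}, fun i => Finset.filter_subset _ _, ?_⟩
  ext e
  rw [mem_glue]
  constructor
  · rintro ⟨i, d, hd, rfl⟩
    exact (Finset.mem_filter.1 hd).2
  · intro he
    obtain ⟨i, d, hd, rfl⟩ := mem_sierpE_succ.1 (hF he)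
    exact ⟨i, d, Finset.mem_filter.2 ⟨hd, he⟩, rfl⟩

theorem card_glue (hf : ∀ i, f i ⊆ sierpE n) : (glue f).card = ∑ i, (f i).card := by
  rw [glue, Finset.card_biUnion]
  · exact Finset.sum_congr rfl fun i _ =>
      Finset.card_image_of_injective _ (Sym2.map.injective (psi_injective i))
  · intro i _ k _ hik
    refine Finset.disjoint_left.2 fun e hi hk => ?_
    obtain ⟨d, hd, rfl⟩ := Finset.mem_image.1 hi
    obtain ⟨d', hd', h⟩ := Finset.mem_image.1 hk
    exact hik (map_psi_eq_map_psi (hf k hd') (hf i hd) h).1.symm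

theorem card_sierpV_succ (n : ℕ) : (sierpV (n + 1)).card + 3 = 3 * (sierpV n).card := by
  have hcard (i : Fin 3) : ((sierpV n).image (psi i)).card = (sierpV n).card :=
    Finset.card_image_of_injective _ (psi_injective i)
  have hinter {i k : Fin 3} (hik : i ≠ k) :
      (sierpV n).image (psi i) ∩ (sierpV n).image (psi k) = {psi i (cornerPt k)} := by
    ext x
    rw [Finset.mem_inter, Finset.mem_image, Finset.mem_image, Finset.mem_singleton]
    constructor
    · rintro ⟨⟨v, hv, rfl⟩, w, hw, h⟩
      obtain h' | h' := psi_eq_psi hv hw h.symm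
      exacts [absurd h'.1 hik, congrArg _ h'.2.1]
    · rintro rfl
      exact ⟨⟨_, cornerPt_mem_sierpV n k, rfl⟩, _, cornerPt_mem_sierpV n i, psi_corner_comm k i⟩
  have hne : psi 0 (cornerPt 2) ≠ psi 1 (cornerPt 2) := by
    intro h
    obtain h' | h' := psi_eq_psi (cornerPt_mem_sierpV 0 2) (cornerPt_mem_sierpV 0 2) h
    · simp at h'
    · exact absurd (cornerPt_injective h'.2.1) (by simp)
  have h01 := Finset.card_union_add_card_inter ((sierpV n).image (psi 0)) ((sierpV n).image (psi 1))
  have h012 := Finset.card_union_add_card_inter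
    ((sierpV n).image (psi 0) ∪ (sierpV n).image (psi 1)) ((sierpV n).image (psi 2))
  rw [hinter (by simp), Finset.card_singleton, hcard, hcard] at h01
  rw [Finset.union_inter_distrib_right, hinter (by simp), hinter (by simp), hcard,
    ← Finset.insert_eq, Finset.card_pair hne] at h012
  rw [sierpV]
  omega

/-- Connectivity inside each cell. -/
abbrev cellReach (f : Fin 3 → Finset (Sym2 Pt)) (i : Fin 3) : Pt → Pt → Prop :=
  (graphOf (f i)).Reachable

theorem cellReach_equivalence (f : Fin 3 → Finset (Sym2 Pt)) (i : Fin 3) :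
    Equivalence (cellReach f i) :=
  (graphOf (f i)).reachable_is_equivalence

/-- The similitude `ψ_i` embeds the cell into the glued graph. -/
def cellHom (f : Fin 3 → Finset (Sym2 Pt)) (i : Fin 3) : graphOf (f i) →g graphOf (glue f) where
  toFun := psi i
  map_rel' {x y} h := by
    rw [graphOf_adj] at h ⊢
    exact ⟨mem_glue.2 ⟨i, _, h.1, rfl⟩, (psi_injective i).ne h.2⟩

theorem reachable_glue_of_cellReach {i : Fin 3} {v w : Pt} (h : cellReach f i v w) :
    (graphOf (glue f)).Reachable (psi i v) (psi i w) :=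
  h.map (cellHom f i)

theorem reachable_glue_of_linked {a i : Fin 3} {v : Pt} (h : Linked (cellReach f) cornerPt a i v) :
    (graphOf (glue f)).Reachable (cornerPt a) (psi i v) := by
  have step {i j : Fin 3} (h : (graphOf (glue f)).Reachable (cornerPt a) (psi i (cornerPt j)))
      {w : Pt} (hw : cellReach f j (cornerPt i) w) :
      (graphOf (glue f)).Reachable (cornerPt a) (psi j w) :=
    h.trans (psi_corner_comm i j ▸ reachable_glue_of_cellReach hw)
  have start {w : Pt} (hw : cellReach f a (cornerPt a) w) :
      (graphOf (glue f)).Reachable (cornerPt a) (psi a w) := by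
    simpa only [psi_corner] using reachable_glue_of_cellReach hw
  obtain ⟨rfl, h1⟩ | ⟨-, h1, h2⟩ | ⟨b, -, -, -, h1, h2, h3⟩ |
    ⟨b, c, rfl, -, -, -, h1, h2, h3, h4⟩ := h
  exacts [start h1, step (start h1) h2, step (step (start h1) h2) h3,
    step (step (step (start h1) h2) h3) h4]

theorem reachable_glue_iff (hf : ∀ i, f i ⊆ sierpE n) {a i : Fin 3} {v : Pt}
    (hv : v ∈ sierpV n) :
    (graphOf (glue f)).Reachable (cornerPt a) (psi i v) ↔
      Linked (cellReach f) cornerPt a i v := by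
  refine ⟨fun h => ?_, reachable_glue_of_linked⟩
  have transfer {i k : Fin 3} {v w : Pt} (hv : v ∈ sierpV n) (hw : w ∈ sierpV n)
      (h : psi i v = psi k w) (hl : Linked (cellReach f) cornerPt a i v) :
      Linked (cellReach f) cornerPt a k w := by
    obtain ⟨rfl, rfl⟩ | ⟨-, rfl, rfl⟩ := psi_eq_psi hv hw h
    exacts [hl, hl.switch (cellReach_equivalence f)]
  obtain ⟨k, w, hw, hwv, hl⟩ : ∃ k, ∃ w ∈ sierpV n, psi k w = psi i v ∧
      Linked (cellReach f) cornerPt a k w := by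
    refine h.of_forall_adj (K := fun x => ∃ k, ∃ w ∈ sierpV n, psi k w = x ∧
      Linked (cellReach f) cornerPt a k w)
      ⟨a, _, cornerPt_mem_sierpV n a, psi_corner a, .inl ⟨rfl, .rfl⟩⟩ ?_
    rintro x y hxy ⟨k, w, hw, rfl, hl⟩
    rw [graphOf_adj, mem_glue] at hxy
    obtain ⟨⟨j, d, hd, hdxy⟩, hne⟩ := hxy
    have hmem := (sierpE_spec (hf j hd)).2
    have hk : psi k w ∈ Sym2.map (psi j) d := by rw [hdxy]; simp
    obtain ⟨x', hx', hxw⟩ := Sym2.mem_map.1 hk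
    obtain ⟨y', rfl⟩ := Sym2.mem_iff_exists.1 hx'
    rw [Sym2.map_mk, hxw, Sym2.congr_right] at hdxy
    refine ⟨j, y', hmem y' (by simp), hdxy,
      (transfer hw (hmem x' (by simp)) hxw.symm hl).trans (cellReach_equivalence f) ?_⟩
    refine SimpleGraph.Adj.reachable (graphOf_adj.2 ⟨hd, ?_⟩)
    rintro rfl
    exact hne (hxw.symm.trans hdxy)
  exact transfer hw hv hwv hl

/-- The spanning forests of `G_n` in which every component contains a corner and which connect the
corners according to the pattern `q`. -/
def cornerForests (n : ℕ) (q : Pattern) : Finset (Finset (Sym2 Pt)) :=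
  (sierpE n).powerset.filter fun F =>
    (graphOf F).IsAcyclic ∧ (∀ x ∈ sierpV n, ∃ j, (graphOf F).Reachable (cornerPt j) x) ∧
      ∀ j k, (graphOf F).Reachable (cornerPt j) (cornerPt k) ↔ q.Rel j k

theorem mem_cornerForests {F : Finset (Sym2 Pt)} {q : Pattern} :
    F ∈ cornerForests n q ↔ F ⊆ sierpE n ∧ (graphOf F).IsAcyclic ∧
      (∀ x ∈ sierpV n, ∃ j, (graphOf F).Reachable (cornerPt j) x) ∧
      ∀ j k, (graphOf F).Reachable (cornerPt j) (cornerPt k) ↔ q.Rel j k := by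
  rw [cornerForests, Finset.mem_filter, Finset.mem_powerset]

theorem componentCount_eq_parts {F : Finset (Sym2 Pt)} {q : Pattern}
    (hcov : ∀ x ∈ sierpV n, ∃ j, (graphOf F).Reachable (cornerPt j) x)
    (hq : ∀ j k, (graphOf F).Reachable (cornerPt j) (cornerPt k) ↔ q.Rel j k) :
    componentCount (sierpV n) F = q.parts := by
  have himage : (sierpV n).image (graphOf F).connectedComponentMk =
      Finset.univ.image fun j => (graphOf F).connectedComponentMk (cornerPt j) := by
    ext c
    simp only [Finset.mem_image, Finset.mem_univ, true_and]
    constructor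
    · rintro ⟨x, hx, rfl⟩
      obtain ⟨j, hj⟩ := hcov x hx
      exact ⟨j, SimpleGraph.ConnectedComponent.eq.2 hj⟩
    · rintro ⟨j, rfl⟩
      exact ⟨_, cornerPt_mem_sierpV n j, rfl⟩
  have hmk (j k : Fin 3) : (graphOf F).connectedComponentMk (cornerPt j) =
      (graphOf F).connectedComponentMk (cornerPt k) ↔ q.Rel j k := by
    rw [SimpleGraph.ConnectedComponent.eq, hq]
  have huniv : (Finset.univ : Finset (Fin 3)) = {0, 1, 2} := by
    ext j; fin_cases j <;> simp
  rw [componentCount, himage, huniv, Finset.image_insert, Finset.image_insert,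
    Finset.image_singleton]
  rcases q with _ | i | _
  · simp [(hmk 0 1).2 trivial, (hmk 1 2).2 trivial, Pattern.parts]
  · fin_cases i
    · rw [(hmk 1 2).2 (by simp [Pattern.Rel]), Finset.pair_eq_singleton, Finset.card_pair]
      · rfl
      · simp [hmk 0 2, Pattern.Rel, -SimpleGraph.ConnectedComponent.eq]
    · rw [(hmk 0 2).2 (by simp [Pattern.Rel]), Finset.insert_eq_of_mem (by simp),
        Finset.card_pair]
      · rfl
      · simp [hmk 1 2, Pattern.Rel, -SimpleGraph.ConnectedComponent.eq]
    · rw [(hmk 0 1).2 (by simp [Pattern.Rel]), Finset.insert_eq_of_mem (by simp),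
        Finset.card_pair]
      · rfl
      · simp [hmk 1 2, Pattern.Rel, -SimpleGraph.ConnectedComponent.eq]
  · rw [Finset.card_insert_of_notMem, Finset.card_pair]
    · rfl
    all_goals simp [hmk, Pattern.Rel, -SimpleGraph.ConnectedComponent.eq]

theorem isAcyclic_iff_card_add_parts {F : Finset (Sym2 Pt)} {q : Pattern} (hF : F ⊆ sierpE n)
    (hcov : ∀ x ∈ sierpV n, ∃ j, (graphOf F).Reachable (cornerPt j) x)
    (hq : ∀ j k, (graphOf F).Reachable (cornerPt j) (cornerPt k) ↔ q.Rel j k) :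
    (graphOf F).IsAcyclic ↔ F.card + q.parts = (sierpV n).card := by
  rw [(card_le_and_isAcyclic_iff_card_add_componentCount fun e he => sierpE_spec (hF he)).2,
    componentCount_eq_parts hcov hq]

theorem Pattern.exists_rel_iff {r : Fin 3 → Fin 3 → Prop} (hr : Equivalence r) :
    ∃ q : Pattern, ∀ j k, r j k ↔ q.Rel j k := by
  have hsymm (j k : Fin 3) : r j k ↔ r k j := ⟨hr.symm, hr.symm⟩
  have h012 := hr.trans (x := 0) (y := 1) (z := 2)
  have h021 := hr.trans (x := 0) (y := 2) (z := 1)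
  have h102 := hr.trans (x := 1) (y := 0) (z := 2)
  rw [hsymm 1 0] at h102
  rw [hsymm 2 1] at h021
  by_cases h01 : r 0 1 <;> by_cases h12 : r 1 2 <;> by_cases h02 : r 0 2 <;>
    simp only [h01, h12, h02, imp_false, not_true, forall_const] at h012 h021 h102
  on_goal 1 => refine ⟨.joined, ?_⟩
  on_goal 2 => refine ⟨.split 2, ?_⟩
  on_goal 3 => refine ⟨.split 0, ?_⟩
  on_goal 4 => refine ⟨.split 1, ?_⟩
  on_goal 5 => refine ⟨.separate, ?_⟩
  all_goals simp [Fin.forall_fin_succ, Pattern.Rel, hr.refl, hsymm 1 0, hsymm 2 0, hsymm 2 1, *]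

theorem cornerForests_disjoint {F : Finset (Sym2 Pt)} {p q : Pattern}
    (hp : F ∈ cornerForests n p) (hq : F ∈ cornerForests n q) : p = q := by
  have hp := (mem_cornerForests.1 hp).2.2.2
  have hq := (mem_cornerForests.1 hq).2.2.2
  exact Pattern.eq_of_rel_iff fun j k => (hp j k).symm.trans (hq j k)

theorem linked_iff_of_mem {p : Fin 3 → Pattern} (hfp : ∀ i, f i ∈ cornerForests n (p i))
    (a i v : Fin 3) : Linked (cellReach f) cornerPt a i (cornerPt v) ↔
      Linked (fun i => (p i).Rel) id a i v :=
  linked_congr (fun i => (mem_cornerForests.1 (hfp i)).2.2.2) a i v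

theorem glue_mem_cornerForests_iff {p : Fin 3 → Pattern} {q : Pattern}
    (hfp : ∀ i, f i ∈ cornerForests n (p i)) :
    glue f ∈ cornerForests (n + 1) q ↔ Glues p q := by
  have hf (i : Fin 3) : f i ⊆ sierpE n := (mem_cornerForests.1 (hfp i)).1
  have hcov : (∀ x ∈ sierpV (n + 1), ∃ j, (graphOf (glue f)).Reachable (cornerPt j) x) ↔
      ∀ i j, ∃ a, Linked (fun i => (p i).Rel) id a i j := by
    constructor
    · intro h i j
      obtain ⟨a, ha⟩ := h (psi i (cornerPt j))
        (mem_sierpV_succ.2 ⟨i, _, cornerPt_mem_sierpV n j, rfl⟩)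
      rw [reachable_glue_iff hf (cornerPt_mem_sierpV n j), linked_iff_of_mem hfp] at ha
      exact ⟨a, ha⟩
    · intro h x hx
      obtain ⟨i, v, hv, rfl⟩ := mem_sierpV_succ.1 hx
      obtain ⟨j, hj⟩ := (mem_cornerForests.1 (hfp i)).2.2.1 v hv
      obtain ⟨a, ha⟩ := h i j
      rw [← linked_iff_of_mem hfp] at ha
      exact ⟨a, reachable_glue_of_linked (ha.trans (cellReach_equivalence f) hj)⟩
  have hrel : (∀ a b, (graphOf (glue f)).Reachable (cornerPt a) (cornerPt b) ↔ q.Rel a b) ↔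
      ∀ a b, Linked (fun i => (p i).Rel) id a b b ↔ q.Rel a b := by
    refine forall₂_congr fun a b => ?_
    rw [← linked_iff_of_mem hfp, ← reachable_glue_iff hf (cornerPt_mem_sierpV n b), psi_corner]
  have hcard : ∑ i, (f i).card + ∑ i, (p i).parts = 3 * (sierpV n).card := by
    have (i : Fin 3) : (f i).card + (p i).parts = (sierpV n).card :=
      have h := (mem_cornerForests.1 (hfp i)).2
      (isAcyclic_iff_card_add_parts (hf i) h.2.1 h.2.2).1 h.1
    simp [← Finset.sum_add_distrib, this]
  have hV := card_sierpV_succ n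
  rw [mem_cornerForests, Glues]
  constructor
  · rintro ⟨-, h1, h2, h3⟩
    rw [isAcyclic_iff_card_add_parts (glue_subset hf) h2 h3, card_glue hf] at h1
    exact ⟨by omega, hcov.1 h2, hrel.1 h3⟩
  · rintro ⟨h1, h2, h3⟩
    refine ⟨glue_subset hf, ?_, hcov.2 h2, hrel.2 h3⟩
    rw [isAcyclic_iff_card_add_parts (glue_subset hf) (hcov.2 h2) (hrel.2 h3), card_glue hf]
    omega

theorem exists_mem_cornerForests_of_glue_mem {q : Pattern} (hf : ∀ i, f i ⊆ sierpE n)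
    (h : glue f ∈ cornerForests (n + 1) q) (i : Fin 3) : ∃ p, f i ∈ cornerForests n p := by
  obtain ⟨-, hacyc, hcov, -⟩ := mem_cornerForests.1 h
  obtain ⟨p, hp⟩ := Pattern.exists_rel_iff
    ((cellReach_equivalence f i).comap cornerPt)
  refine ⟨p, mem_cornerForests.2 ⟨hf i, hacyc.comap (cellHom f i) (psi_injective i), ?_, hp⟩⟩
  intro v hv
  obtain ⟨a, ha⟩ := hcov (psi i v) (mem_sierpV_succ.2 ⟨i, v, hv, rfl⟩)
  exact ((reachable_glue_iff hf hv).1 ha).exists_corner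

theorem card_cornerForests_succ (n : ℕ) (q : Pattern) :
    (cornerForests (n + 1) q).card =
      ∑ p with Glues p q, ∏ i, (cornerForests n (p i)).card := by
  have hunion : cornerForests (n + 1) q = (Finset.univ.filter (Glues · q)).biUnion fun p =>
      (Fintype.piFinset fun i => cornerForests n (p i)).image glue := by
    ext F
    simp only [Finset.mem_biUnion, Finset.mem_filter, Finset.mem_univ, true_and,
      Finset.mem_image, Fintype.mem_piFinset]
    constructor
    · intro hF
      obtain ⟨f, hf, rfl⟩ := exists_glue_eq (mem_cornerForests.1 hF).1
      choose p hp using exists_mem_cornerForests_of_glue_mem hf hF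
      exact ⟨p, (glue_mem_cornerForests_iff hp).1 hF, f, hp, rfl⟩
    · rintro ⟨p, hpq, f, hf, rfl⟩
      exact (glue_mem_cornerForests_iff hf).2 hpq
  have hsub {f : Fin 3 → Finset (Sym2 Pt)} {p : Fin 3 → Pattern}
      (h : f ∈ Fintype.piFinset fun i => cornerForests n (p i)) (i : Fin 3) : f i ⊆ sierpE n :=
    (mem_cornerForests.1 (Fintype.mem_piFinset.1 h i)).1
  rw [hunion, Finset.card_biUnion]
  · refine Finset.sum_congr rfl fun p _ => ?_
    rw [Finset.card_image_of_injOn, Fintype.card_piFinset]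
    exact fun f hf g hg => glue_injOn (hsub hf) (hsub hg)
  · refine fun p _ p' _ hpp' => Finset.disjoint_left.2 fun F hF hF' => hpp' ?_
    obtain ⟨f, hf, rfl⟩ := Finset.mem_image.1 hF
    obtain ⟨g, hg, hgf⟩ := Finset.mem_image.1 hF'
    obtain rfl := glue_injOn (hsub hg) (hsub hf) hgf
    exact funext fun i => cornerForests_disjoint (Fintype.mem_piFinset.1 hf i)
      (Fintype.mem_piFinset.1 hg i)

/-- The edge of `G_0` opposite to corner `i`. -/
def oppositeEdge (i : Fin 3) : Sym2 Pt := s(cornerPt (i + 1), cornerPt (i + 2))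

theorem mk_cornerPt_eq_oppositeEdge {i j k : Fin 3} (hj : i ≠ j) (hk : i ≠ k) (hjk : j ≠ k) :
    s(cornerPt j, cornerPt k) = oppositeEdge i := by
  have : (j = i + 1 ∧ k = i + 2) ∨ (j = i + 2 ∧ k = i + 1) := by omega
  obtain ⟨rfl, rfl⟩ | ⟨rfl, rfl⟩ := this
  exacts [rfl, Sym2.eq_swap]

theorem cornerPt_mem_oppositeEdge {i j : Fin 3} : cornerPt j ∈ oppositeEdge i ↔ i ≠ j := by
  rw [oppositeEdge, Sym2.mem_iff, cornerPt_injective.eq_iff, cornerPt_injective.eq_iff]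
  omega

theorem oppositeEdge_injective : Function.Injective oppositeEdge := by
  intro i j h
  by_contra hij
  exact cornerPt_mem_oppositeEdge.1 (h ▸ cornerPt_mem_oppositeEdge.2 (Ne.symm hij) :
    cornerPt i ∈ oppositeEdge i) rfl

theorem sierpE_zero : sierpE 0 = Finset.univ.image oppositeEdge := by
  ext e
  simp [sierpE, Fin.exists_fin_succ, oppositeEdge, eq_comm]
  tauto

theorem reachable_image_oppositeEdge_iff {A : Finset (Fin 3)} {j k : Fin 3} :
    (graphOf (A.image oppositeEdge)).Reachable (cornerPt j) (cornerPt k) ↔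
      TriangleLinked A j k := by
  have edge {i j k : Fin 3} (hi : i ∈ A) (hj : i ≠ j) (hk : i ≠ k) :
      (graphOf (A.image oppositeEdge)).Reachable (cornerPt j) (cornerPt k) := by
    by_cases hjk : j = k
    · rw [hjk]
    · refine SimpleGraph.Adj.reachable (graphOf_adj.2 ⟨?_, cornerPt_injective.ne hjk⟩)
      rw [mk_cornerPt_eq_oppositeEdge hj hk hjk]
      exact Finset.mem_image_of_mem _ hi
  constructor
  · intro h
    obtain ⟨l, hl, hjl⟩ := h.of_forall_adj
      (K := fun x => ∃ l, cornerPt l = x ∧ TriangleLinked A j l) ⟨j, rfl, .inl rfl⟩ (by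
        rintro _ y hxy ⟨l, rfl, hjl⟩
        obtain ⟨hmem, hne⟩ := graphOf_adj.1 hxy
        obtain ⟨i, hi, hie⟩ := Finset.mem_image.1 hmem
        have hl : cornerPt l ∈ oppositeEdge i := by rw [hie]; simp
        have hy : y ∈ oppositeEdge i := by rw [hie]; simp
        obtain ⟨m, rfl⟩ : ∃ m, cornerPt m = y := by
          obtain rfl | rfl := Sym2.mem_iff.1 hy <;> exact ⟨_, rfl⟩
        exact ⟨m, rfl, hjl.trans_edge hi (cornerPt_mem_oppositeEdge.1 hl)
          (cornerPt_mem_oppositeEdge.1 hy)⟩)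
    rwa [← cornerPt_injective hl]
  · rintro (rfl | ⟨i, hi, hj, hk⟩ | ⟨hj, hk⟩)
    · rfl
    · exact edge hi hj hk
    · by_cases hjk : j = k
      · rw [hjk]
      · obtain ⟨l, hlj, hlk⟩ := Fin.exists_ne_and_ne_of_two_lt j k (by norm_num)
        exact (edge hk (Ne.symm hjk) hlk.symm).trans (edge hj hlj.symm hjk)

theorem card_cornerForests_zero (q : Pattern) :
    (cornerForests 0 q).card = if q = .joined then 3 else 1 := by
  have hV : sierpV 0 = Finset.univ.image cornerPt := by
    ext x; simp [sierpV, Fin.exists_fin_succ, eq_comm]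
  have hcov (F : Finset (Sym2 Pt)) : ∀ x ∈ sierpV 0, ∃ j, (graphOf F).Reachable (cornerPt j) x := by
    intro x hx
    obtain ⟨j, -, rfl⟩ := Finset.mem_image.1 (hV ▸ hx)
    exact ⟨j, .rfl⟩
  have himage : cornerForests 0 q = (Finset.univ.filter fun A : Finset (Fin 3) =>
      A.card + q.parts = 3 ∧ ∀ j k, TriangleLinked A j k ↔ q.Rel j k).image
        (Finset.image oppositeEdge) := by
    ext F
    rw [mem_cornerForests, sierpE_zero, Finset.subset_image_iff]
    simp only [Finset.mem_image, Finset.mem_filter, Finset.mem_univ, true_and]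
    have key (A : Finset (Fin 3)) :
        ((graphOf (A.image oppositeEdge)).IsAcyclic ∧
          (∀ x ∈ sierpV 0, ∃ j, (graphOf (A.image oppositeEdge)).Reachable (cornerPt j) x) ∧
          ∀ j k, (graphOf (A.image oppositeEdge)).Reachable (cornerPt j) (cornerPt k) ↔
            q.Rel j k) ↔
        A.card + q.parts = 3 ∧ ∀ j k, TriangleLinked A j k ↔ q.Rel j k := by
      simp only [← reachable_image_oppositeEdge_iff]
      rw [and_iff_right (hcov _)]
      refine and_congr_left fun h => ?_
      rw [isAcyclic_iff_card_add_parts (n := 0)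
        (by rw [sierpE_zero]; exact Finset.image_subset_image (Finset.subset_univ _)) (hcov _) h,
        Finset.card_image_of_injective _ oppositeEdge_injective, hV,
        Finset.card_image_of_injective _ cornerPt_injective]
      simp
    constructor
    · rintro ⟨⟨A, -, rfl⟩, h⟩
      exact ⟨A, (key A).1 h, rfl⟩
    · rintro ⟨A, h, rfl⟩
      exact ⟨⟨A, Set.subset_univ _ |>.trans (by simp), rfl⟩, (key A).2 h⟩
  rw [himage, Finset.card_image_of_injective _ (Finset.image_injective oppositeEdge_injective)]
  convert card_triangle_patterns q

theorem twoForestSet_eq (n : ℕ) (i : Fin 3) : twoForestSet n i = cornerForests n (.split i) := by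
  ext F
  rw [twoForestSet, Finset.mem_filter, Finset.mem_powerset, mem_cornerForests]
  refine and_congr_right fun _ => and_congr_right fun _ => ?_
  constructor
  · rintro ⟨h1, h2, h3⟩
    refine ⟨h3, fun j k => ?_⟩
    by_cases hj : j = i <;> by_cases hk : k = i
    · simp [hj, hk, Pattern.Rel]
    · simp [hj, hk, Pattern.Rel, h1]
    · simp [hj, hk, Pattern.Rel, SimpleGraph.reachable_comm (u := cornerPt j), h1]
    · simp [hj, hk, Pattern.Rel, h2]
  · rintro ⟨h3, h⟩
    refine ⟨fun j hj => ?_, fun j k hj hk => ?_, h3⟩ <;> simp_all [Pattern.Rel]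

theorem threeForestSet_eq (n : ℕ) : threeForestSet n = cornerForests n .separate := by
  ext F
  rw [threeForestSet, Finset.mem_filter, Finset.mem_powerset, mem_cornerForests]
  refine and_congr_right fun _ => and_congr_right fun _ => ?_
  constructor
  · rintro ⟨h1, h3⟩
    refine ⟨h3, fun j k => ⟨fun h => ?_, ?_⟩⟩
    · by_contra hjk
      exact h1 j k hjk h
    · rintro rfl
      rfl
  · rintro ⟨h3, h⟩
    exact ⟨fun j k hjk => by rw [h]; exact hjk, h3⟩

theorem card_cornerForests (n : ℕ) (q : Pattern) :
    ((cornerForests n q).card : ℝ) =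
      (match q with
        | .joined => 3 * (5 / 3) ^ (-(n : ℝ) / 2)
        | .split _ => (5 / 3) ^ ((n : ℝ) / 2)
        | .separate => (5 / 3) ^ (3 * (n : ℝ) / 2)) * 540 ^ (((3 : ℝ) ^ n - 1) / 4) := by
  induction n generalizing q with
  | zero =>
    rw [card_cornerForests_zero]
    rcases q with _ | i | _ <;> simp
  | succ n ih =>
    have hs (i : Fin 3) :
        (cornerForests n (.split i)).card = (cornerForests n (.split 0)).card := by
      have := (ih (.split i)).trans (ih (.split 0)).symm
      exact_mod_cast this
    have ht := ih .joined
    have hs0 := ih (.split 0)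
    have hr := ih .separate
    dsimp only at ht hs0 hr
    set a : ℝ := (5 / 3) ^ ((n : ℝ) / 2) with ha
    set c : ℝ := 540 ^ (((3 : ℝ) ^ n - 1) / 4) with hc
    have ha0 : a ≠ 0 := (Real.rpow_pos_of_pos (by norm_num) _).ne'
    have ha1 : (5 / 3 : ℝ) ^ (-(n : ℝ) / 2) = a⁻¹ := by
      rw [neg_div, Real.rpow_neg (by norm_num)]
    have ha3 : (5 / 3 : ℝ) ^ (3 * (n : ℝ) / 2) = a ^ 3 := by
      rw [ha, ← Real.rpow_mul_natCast (by norm_num)]; congr 1; push_cast; ring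
    rw [ha1] at ht
    rw [ha3] at hr
    set b : ℝ := (5 / 3) ^ (1 / 2 : ℝ) with hb
    set d : ℝ := 540 ^ (1 / 2 : ℝ) with hd
    have hb0 : b ≠ 0 := (Real.rpow_pos_of_pos (by norm_num) _).ne'
    have hb2 : b ^ 2 = 5 / 3 := by
      rw [hb, ← Real.rpow_mul_natCast (by norm_num)]; norm_num
    have hbd : b * d = 30 := by
      rw [hb, hd, ← Real.mul_rpow (by norm_num) (by norm_num), ← Real.sqrt_eq_rpow,
        Real.sqrt_eq_iff_mul_self_eq_of_pos] <;> norm_num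
    have hd' : d = 18 * b := by
      refine mul_left_cancel₀ hb0 ?_
      rw [hbd]; linear_combination -18 * hb2
    have ha' : (5 / 3 : ℝ) ^ (((n + 1 : ℕ) : ℝ) / 2) = a * b := by
      rw [ha, hb, ← Real.rpow_add (by norm_num)]; congr 1; push_cast; ring
    have ha1' : (5 / 3 : ℝ) ^ (-((n + 1 : ℕ) : ℝ) / 2) = (a * b)⁻¹ := by
      rw [neg_div, Real.rpow_neg (by norm_num), ha']
    have ha3' : (5 / 3 : ℝ) ^ (3 * ((n + 1 : ℕ) : ℝ) / 2) = (a * b) ^ 3 := by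
      rw [← ha', ← Real.rpow_mul_natCast (by norm_num)]; congr 1; push_cast; ring
    have hc' : (540 : ℝ) ^ (((3 : ℝ) ^ (n + 1) - 1) / 4) = c ^ 3 * (18 * b) := by
      rw [← hd', hc, hd, ← Real.rpow_mul_natCast (by norm_num), ← Real.rpow_add (by norm_num)]
      congr 1; push_cast; ring
    rw [hc', ha', ha1', ha3', card_cornerForests_succ]
    rcases q with _ | i | _
    · have h := sum_glues_joined (w := fun q => (cornerForests n q).card) rfl hs rfl
      have h' : ((∑ p with Glues p .joined, ∏ i, (cornerForests n (p i)).card : ℕ) : ℝ) =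
          6 * (3 * a⁻¹ * c) ^ 2 * (a * c) := by
        rw [← ht, ← hs0]; exact_mod_cast (by convert h)
      rw [h']
      field_simp
      ring
    · have h := sum_glues_split (w := fun q => (cornerForests n q).card) rfl hs rfl i
      have h' : ((∑ p with Glues p (.split i), ∏ i, (cornerForests n (p i)).card : ℕ) : ℝ) =
          7 * (3 * a⁻¹ * c) * (a * c) ^ 2 + (3 * a⁻¹ * c) ^ 2 * (a ^ 3 * c) := by
        rw [← ht, ← hs0, ← hr]; exact_mod_cast (by convert h)
      rw [h']
      field_simp
      linear_combination -18 * c ^ 3 * hb2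
    · have h := sum_glues_separate (w := fun q => (cornerForests n q).card) rfl hs rfl
      have h' : ((∑ p with Glues p .separate, ∏ i, (cornerForests n (p i)).card : ℕ) : ℝ) =
          14 * (a * c) ^ 3 + 12 * (3 * a⁻¹ * c) * (a * c) * (a ^ 3 * c) := by
        rw [← ht, ← hs0, ← hr]; exact_mod_cast (by convert h)
      rw [h']
      field_simp
      linear_combination c ^ 3 * (-18 * b ^ 2 - 30) * hb2

end Sierpinski

/-- explicit formulae for the numbers of two- and three-component
spanning forests of `G_n`. -/
theorem spanning_forest_count (n : ℕ) :
    (∀ i : Fin 3,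
        ((twoForestSet n i).card : ℝ) =
          (5 / 3) ^ ((n : ℝ) / 2) * 540 ^ (((3 : ℝ) ^ n - 1) / 4)) ∧
      ((threeForestSet n).card : ℝ) =
        (5 / 3) ^ (3 * (n : ℝ) / 2) * 540 ^ (((3 : ℝ) ^ n - 1) / 4) ∧
      (twoForestSet n 0).card = (twoForestSet n 1).card ∧
      (twoForestSet n 1).card = (twoForestSet n 2).card := by
  simp only [twoForestSet_eq, threeForestSet_eq]
  have hs (i : Fin 3) := card_cornerForests n (.split i)
  refine ⟨hs, card_cornerForests n .separate, ?_, ?_⟩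
  · exact_mod_cast (hs 0).trans (hs 1).symm
  · exact_mod_cast (hs 1).trans (hs 2).symm

end
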